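/- Let n ∈ ℕ and let h_n be the n-th Hermite function, h_n(x) = e^{πx²} (dⁿ/dxⁿ)(e^{−2πx²}). If α, β > 0 are such that αβ is rational and αβ ≤ 1, then the Gabor system G(h_n, α, β) is complete in L²(ℝ). -/

import Mathlib

open MeasureTheory Complex Real

/-- The Gabor system `G(g, α, β)` is complete in `L²(ℝ)`: the finite linear span of the
time-frequency shifts `x ↦ e^{2πiβlx} g(x − αk)`, `k, l ∈ ℤ`, is dense in `L²(ℝ, ℂ)`. -/
def GaborComplete (g : ℝ → ℂ) (α β : ℝ) : Prop :=
  (Submodule.span ℂ {h : Lp ℂ 2 (volume : Measure ℝ) |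
      ∃ k l : ℤ, ∀ᵐ x : ℝ, h x =
        Complex.exp (2 * Real.pi * Complex.I * (β * l * x)) * g (x - α * k)}).topologicalClosure
    = ⊤

/-- The `n`-th Hermite function `h_n(x) = e^{πx²} (dⁿ/dxⁿ)(e^{−2πx²})`. -/
noncomputable def hermiteFn (n : ℕ) (x : ℝ) : ℂ :=
  (Real.exp (Real.pi * x ^ 2) *
    iteratedDeriv n (fun t : ℝ => Real.exp (-(2 * Real.pi) * t ^ 2)) x : ℝ)

lemma integral_mul_continuous_eq_zero {T : ℝ} [Fact (0 < T)] {F : AddCircle T → ℂ}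
    (hF : Integrable F AddCircle.haarAddCircle) (h0 : ∀ n : ℤ, fourierCoeff F n = 0)
    (φ : C(AddCircle T, ℂ)) : ∫ x, F x * φ x ∂AddCircle.haarAddCircle = 0 := by
  have hInt : ∀ φ : C(AddCircle T, ℂ), Integrable (fun x => F x * φ x) AddCircle.haarAddCircle :=
    fun φ => hF.mul_bdd (c := ‖φ‖) φ.continuous.aestronglyMeasurable
      (Filter.Eventually.of_forall fun x => φ.norm_coe_le_norm x)
  let Λ : C(AddCircle T, ℂ) →ₗ[ℂ] ℂ :=
    { toFun := fun φ => ∫ x, F x * φ x ∂AddCircle.haarAddCircle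
      map_add' := fun φ ψ => by
        simp only [ContinuousMap.add_apply, mul_add]
        exact integral_add (hInt φ) (hInt ψ)
      map_smul' := fun c φ => by
        simp only [ContinuousMap.smul_apply, smul_eq_mul, RingHom.id_apply]
        rw [← integral_const_mul]
        congr 1; ext x; ring }
  have hcont : Continuous Λ := by
    refine (Λ.mkContinuous (∫ x, ‖F x‖ ∂AddCircle.haarAddCircle) fun φ => ?_).continuous
    refine (norm_integral_le_integral_norm _).trans ?_
    rw [← integral_mul_const]
    refine integral_mono (hInt φ).norm (hF.norm.mul_const _) fun x => ?_
    simp only [norm_mul]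
    gcongr
    exact φ.norm_coe_le_norm x
  have hle : (Submodule.span ℂ (Set.range (@fourier T))).topologicalClosure ≤ LinearMap.ker Λ := by
    refine Submodule.topologicalClosure_minimal _ ?_ (isClosed_singleton.preimage hcont)
    rw [Submodule.span_le]
    rintro _ ⟨n, rfl⟩
    have := h0 (-n)
    rw [fourierCoeff, neg_neg] at this
    simpa [Λ, mul_comm] using this
  rw [span_fourier_closure_eq_top] at hle
  exact hle Submodule.mem_top

lemma ae_eq_zero_of_fourierCoeff_eq_zero {T : ℝ} [Fact (0 < T)] {F : AddCircle T → ℂ}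
    (hF : Integrable F AddCircle.haarAddCircle) (h0 : ∀ n : ℤ, fourierCoeff F n = 0) :
    F =ᵐ[AddCircle.haarAddCircle] 0 := by
  refine ae_eq_zero_of_forall_setIntegral_isClosed_eq_zero hF fun s hs => ?_
  have key : ∀ n, ∫ x, F x * ((hs.apprSeq n x : ℝ) : ℂ) ∂AddCircle.haarAddCircle = 0 := fun n =>
    integral_mul_continuous_eq_zero hF h0
      ⟨fun x => ((hs.apprSeq n x : ℝ) : ℂ), by fun_prop⟩
  have lim : Filter.Tendsto
      (fun n => ∫ x, F x * ((hs.apprSeq n x : ℝ) : ℂ) ∂AddCircle.haarAddCircle) Filter.atTop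
      (nhds (∫ x, s.indicator F x ∂AddCircle.haarAddCircle)) := by
    refine tendsto_integral_of_dominated_convergence (fun x => ‖F x‖) (fun n => ?_) hF.norm
      (fun n => Filter.Eventually.of_forall fun x => ?_) (Filter.Eventually.of_forall fun x => ?_)
    · exact hF.1.mul (Continuous.aestronglyMeasurable (by fun_prop))
    · have : ((hs.apprSeq n x : NNReal) : ℝ) ≤ 1 := by
        exact_mod_cast HasOuterApproxClosed.apprSeq_apply_le_one hs n x
      rw [norm_mul, Complex.norm_real, Real.norm_of_nonneg (NNReal.coe_nonneg _)]
      exact mul_le_of_le_one_right (norm_nonneg _) this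
    · have h1 := (tendsto_pi_nhds.mp (HasOuterApproxClosed.tendsto_apprSeq hs)) x
      have h2 : Filter.Tendsto (fun n => F x * ((hs.apprSeq n x : ℝ) : ℂ)) Filter.atTop
          (nhds (F x * (((s.indicator (fun _ => (1 : NNReal)) x : NNReal) : ℝ) : ℂ))) :=
        Filter.Tendsto.const_mul _ ((Complex.continuous_ofReal.tendsto _).comp
          ((NNReal.continuous_coe.tendsto _).comp h1))
      convert! h2 using 2
      by_cases hx : x ∈ s <;> simp [hx]
  rw [← integral_indicator hs.measurableSet]
  exact tendsto_nhds_unique lim (by simp [key])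

lemma ae_summable_norm_of_summable_integral {X ι : Type*} [Countable ι] {_ : MeasurableSpace X}
    {μ : Measure X} {F : ι → X → ℂ} (hF : ∀ i, Integrable (F i) μ)
    (hS : Summable fun i => ∫ x, ‖F i x‖ ∂μ) : ∀ᵐ x ∂μ, Summable fun i => ‖F i x‖ := by
  refine summable_norm_of_tsum_eLpNorm_ne_top le_rfl (fun i => (hF i).1) ?_
  have : ∀ i, eLpNorm (F i) 1 μ = ENNReal.ofReal (∫ x, ‖F i x‖ ∂μ) := fun i => by
    rw [eLpNorm_one_eq_lintegral_enorm, ofReal_integral_norm_eq_lintegral_enorm (hF i)]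
  simp_rw [this]
  exact hS.tsum_ofReal_ne_top

lemma integrable_tsum_of_summable_integral {X ι : Type*} [Countable ι] {_ : MeasurableSpace X}
    {μ : Measure X} {F : ι → X → ℂ} (hF : ∀ i, Integrable (F i) μ)
    (hS : Summable fun i => ∫ x, ‖F i x‖ ∂μ) : Integrable (fun x => ∑' i, F i x) μ := by
  have hae := ae_summable_norm_of_summable_integral hF hS
  refine ⟨aestronglyMeasurable_of_tendsto_ae (u := Filter.atTop)
    (f := fun (s : Finset ι) x => ∑ i ∈ s, F i x)
    (fun s => Finset.aestronglyMeasurable_fun_sum s fun i _ => (hF i).1) ?_, ?_⟩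
  · filter_upwards [hae] with x hx
    exact hx.of_norm.hasSum
  · have h1 : ∫⁻ x, ∑' i, ‖F i x‖ₑ ∂μ < ⊤ := by
      rw [lintegral_tsum fun i => (hF i).1.enorm]
      simp_rw [← ofReal_integral_norm_eq_lintegral_enorm (hF _)]
      exact hS.tsum_ofReal_lt_top
    refine lt_of_le_of_lt (lintegral_mono fun x => ?_) h1
    exact enorm_tsum_le_tsum_enorm

lemma hasSum_setIntegral_add_zsmul {E : Type*} [NormedAddCommGroup E] [NormedSpace ℝ E]
    {T : ℝ} (hT : 0 < T) (a : ℝ) {u : ℝ → E} (hu : Integrable u) :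
    HasSum (fun j : ℤ => ∫ x in Set.Ioc a (a + T), u (x + j * T)) (∫ x, u x) := by
  have h := hasSum_integral_iUnion (μ := volume) (f := u)
    (s := fun n : ℤ => Set.Ioc (a + n • T) (a + (n + 1) • T)) (fun n => measurableSet_Ioc)
    (Set.pairwise_disjoint_Ioc_add_zsmul a T) hu.integrableOn
  rw [iUnion_Ioc_add_zsmul hT a, Measure.restrict_univ] at h
  convert! h using 2 with j
  rw [← intervalIntegral.integral_of_le (by linarith), intervalIntegral.integral_comp_add_right,
    ← intervalIntegral.integral_of_le (by simp only [zsmul_eq_mul]; push_cast; nlinarith)]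
  congr 1
  · simp
  · simp; ring

lemma summable_integral_norm_add_zsmul {T : ℝ} (hT : 0 < T) (a : ℝ) {u : ℝ → ℂ}
    (hu : Integrable u) :
    Summable fun j : ℤ => ∫ x in Set.Ioc a (a + T), ‖u (x + j * T)‖ :=
  (hasSum_setIntegral_add_zsmul hT a hu.norm).summable

lemma setIntegral_tsum_add_zsmul {T : ℝ} (hT : 0 < T) (a : ℝ) {u : ℝ → ℂ} (hu : Integrable u) :
    ∫ x in Set.Ioc a (a + T), ∑' j : ℤ, u (x + j * T) = ∫ x, u x := by
  have hInt : ∀ j : ℤ, IntegrableOn (fun x => u (x + j * T)) (Set.Ioc a (a + T)) :=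
    fun j => (hu.comp_add_right (j * T)).integrableOn
  rw [← integral_tsum_of_summable_integral_norm hInt (summable_integral_norm_add_zsmul hT a hu)]
  exact (hasSum_setIntegral_add_zsmul hT a hu).tsum_eq

lemma ae_of_forall_ae_Ioc {T : ℝ} (hT : 0 < T) {p : ℝ → Prop}
    (h : ∀ a : ℝ, ∀ᵐ x ∂(volume.restrict (Set.Ioc a (a + T))), p x) : ∀ᵐ x, p x := by
  rw [← Measure.restrict_univ (μ := (volume : Measure ℝ)), ← iUnion_Ioc_add_zsmul hT 0,
    ae_restrict_iUnion_iff]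
  intro n
  have := h (0 + n • T)
  rwa [add_assoc, ← add_one_zsmul] at this

lemma ae_summable_norm_periodization {T : ℝ} (hT : 0 < T) {u : ℝ → ℂ} (hu : Integrable u) :
    ∀ᵐ x, Summable fun j : ℤ => ‖u (x + j * T)‖ :=
  ae_of_forall_ae_Ioc hT fun a => ae_summable_norm_of_summable_integral
    (fun j => (hu.comp_add_right (j * T)).integrableOn) (summable_integral_norm_add_zsmul hT a hu)

lemma integrable_lift_haarAddCircle {T : ℝ} [hT : Fact (0 < T)] {F : ℝ → ℂ}
    (hper : Function.Periodic F T) (hF : IntegrableOn F (Set.Ioc 0 (0 + T))) :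
    Integrable hper.lift AddCircle.haarAddCircle := by
  have hT0 : ENNReal.ofReal T ≠ 0 := by simpa using hT.out
  rw [← integrable_smul_measure hT0 ENNReal.ofReal_ne_top, ← AddCircle.volume_eq_smul_haarAddCircle]
  have h1 : Integrable (fun y : Set.Ioc (0 : ℝ) (0 + T) => F y)
      (Measure.comap Subtype.val volume) :=
    (integrableOn_iff_comap_subtypeVal measurableSet_Ioc).mp hF
  have h2 := (AddCircle.measurePreserving_equivIoc T (a := 0)).integrable_comp_of_integrable h1
  convert! h2 using 1
  ext y
  obtain ⟨x, rfl⟩ := (AddCircle.equivIoc T 0).symm.surjective y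
  simp only [Function.comp_apply, Equiv.apply_symm_apply]
  exact hper.lift_coe _

lemma exp_add_period_eq_fourier {T : ℝ} (hT : 0 < T) (n j : ℤ) (x : ℝ) :
    Complex.exp (2 * π * I * n * (x + j * T : ℝ) / T) = fourier n (x : AddCircle T) := by
  rw [fourier_coe_apply, Complex.exp_eq_exp_iff_exists_int]
  refine ⟨n * j, ?_⟩
  have : (T : ℂ) ≠ 0 := by exact_mod_cast hT.ne'
  push_cast
  field_simp

lemma integrable_exp_mul (n : ℤ) (T : ℝ) {u : ℝ → ℂ} (hu : Integrable u) :
    Integrable fun x : ℝ => Complex.exp (2 * π * I * n * x / T) * u x := by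
  refine hu.bdd_mul (c := 1) (Continuous.aestronglyMeasurable (by fun_prop))
    (Filter.Eventually.of_forall fun x => ?_)
  have : 2 * π * I * n * x / T = ((2 * π * n * x / T : ℝ) : ℂ) * I := by
    push_cast; ring
  rw [this, Complex.norm_exp_ofReal_mul_I]

lemma ae_tsum_eq_zero_of_integral_exp_mul_eq_zero {T : ℝ} (hT : 0 < T) {u : ℝ → ℂ}
    (hu : Integrable u)
    (h0 : ∀ l : ℤ, ∫ x : ℝ, Complex.exp (2 * π * I * l * x / T) * u x = 0) :
    ∀ᵐ x, ∑' j : ℤ, u (x + j * T) = 0 := by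
  have : Fact (0 < T) := ⟨hT⟩
  have hper : Function.Periodic (fun x => ∑' j : ℤ, u (x + j * T)) T := fun x => by
    change ∑' j : ℤ, u (x + T + j * T) = ∑' j : ℤ, u (x + j * T)
    rw [← (Equiv.addRight (1 : ℤ)).tsum_eq (fun j : ℤ => u (x + j * T))]
    refine tsum_congr fun j => ?_
    simp only [Equiv.coe_addRight]
    congr 1; push_cast; ring
  have hlift : Integrable hper.lift AddCircle.haarAddCircle :=
    integrable_lift_haarAddCircle hper <| integrable_tsum_of_summable_integral
      (fun j => (hu.comp_add_right (j * T)).integrableOn) (summable_integral_norm_add_zsmul hT 0 hu)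
  have hcoef : ∀ n, fourierCoeff hper.lift n = 0 := fun n => by
    have hw := integrable_exp_mul (-n) T hu
    have h5 : ∀ x : ℝ, fourier (-n) (x : AddCircle T) • hper.lift x
        = ∑' j : ℤ, Complex.exp (2 * π * I * (-n : ℤ) * (x + j * T : ℝ) / T) * u (x + j * T) := by
      intro x
      rw [hper.lift_coe, smul_eq_mul, ← tsum_mul_left]
      exact tsum_congr fun j => by rw [exp_add_period_eq_fourier hT]
    rw [fourierCoeff_eq_intervalIntegral _ n 0, intervalIntegral.integral_of_le (by linarith)]
    simp_rw [h5]
    rw [setIntegral_tsum_add_zsmul hT 0 hw, h0, smul_zero]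
  have hz' : hper.lift =ᵐ[volume] 0 := by
    rw [AddCircle.volume_eq_smul_haarAddCircle]
    exact Measure.ae_smul_measure (ae_eq_zero_of_fourierCoeff_eq_zero hlift hcoef) _
  refine ae_of_forall_ae_Ioc hT fun a => ?_
  exact (AddCircle.measurePreserving_mk T a).quasiMeasurePreserving.ae hz'

/-- The symmetric `q`-product `∏_{i=1}^M (1 - v^{j-i})(1 - v^{-j-i})`. -/
noncomputable def symmQProd (v : ℝ) (M : ℕ) (j : ℤ) : ℝ :=
  ∏ i ∈ Finset.range M, (1 - v ^ (j - (i + 1 : ℤ))) * (1 - v ^ (-j - (i + 1 : ℤ)))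

lemma symmQProd_neg (v : ℝ) (M : ℕ) (j : ℤ) : symmQProd v M (-j) = symmQProd v M j := by
  unfold symmQProd
  exact Finset.prod_congr rfl fun i _ => by rw [neg_neg, mul_comm]

lemma symmQProd_natCast_eq_zero (v : ℝ) {M m : ℕ} (hm : 0 < m) (hM : m ≤ M) :
    symmQProd v M m = 0 := by
  refine Finset.prod_eq_zero (i := m - 1) (Finset.mem_range.mpr (by omega)) ?_
  have : (m : ℤ) - ((m - 1 : ℕ) + 1 : ℤ) = 0 := by omega
  rw [this, zpow_zero, sub_self, zero_mul]

lemma symmQProd_eq_zero (v : ℝ) {M : ℕ} {j : ℤ} (hj : j ≠ 0) (hM : j.natAbs ≤ M) :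
    symmQProd v M j = 0 := by
  rcases Int.natAbs_eq j with h | h
  · rw [h]; exact symmQProd_natCast_eq_zero v (by omega) hM
  · rw [h, symmQProd_neg]; exact symmQProd_natCast_eq_zero v (by omega) hM

lemma abs_one_sub_zpow_le_one {v : ℝ} (hv : 1 < v) {m : ℤ} (hm : m ≤ 0) : |1 - v ^ m| ≤ 1 := by
  have h1 : 0 < v ^ m := zpow_pos (by linarith) m
  have h2 : v ^ m ≤ 1 := zpow_le_one_of_nonpos₀ hv.le hm
  rw [abs_le]; constructor <;> linarith

lemma abs_one_sub_pow_le {v : ℝ} (hv : 1 < v) (m : ℕ) : |1 - v ^ m| ≤ v ^ m := by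
  have h1 : 1 ≤ v ^ m := one_le_pow₀ hv.le
  rw [abs_le]; constructor <;> linarith

lemma abs_symmQProd_natCast_le {v : ℝ} (hv : 1 < v) (M m : ℕ) :
    |symmQProd v M m| ≤ v ^ m.choose 2 := by
  rcases Nat.eq_zero_or_pos m with rfl | hm
  · rw [symmQProd, Finset.abs_prod]
    refine Finset.prod_le_one (fun _ _ => abs_nonneg _) fun i _ => ?_
    rw [abs_mul]
    exact mul_le_one₀ (abs_one_sub_zpow_le_one hv (by lia)) (abs_nonneg _)
      (abs_one_sub_zpow_le_one hv (by lia))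
  rcases le_or_gt m M with h | h
  · rw [symmQProd_natCast_eq_zero v hm h, abs_zero]; positivity
  have h1 : ∏ i ∈ Finset.range m, v ^ (m - 1 - i) = v ^ m.choose 2 := by
    rw [Finset.prod_range_reflect (fun i => v ^ i) m, Finset.prod_pow_eq_pow_sum,
      Finset.sum_range_id, Nat.choose_two_right]
  rw [← h1, symmQProd, Finset.abs_prod]
  calc _ ≤ ∏ i ∈ Finset.range M, v ^ (m - 1 - i) := by
        refine Finset.prod_le_prod (fun _ _ => abs_nonneg _) fun i hi => ?_
        rw [Finset.mem_range] at hi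
        rw [abs_mul, ← mul_one (v ^ (m - 1 - i))]
        refine mul_le_mul ?_ (abs_one_sub_zpow_le_one hv (by omega)) (abs_nonneg _) (by positivity)
        have : (m : ℤ) - (i + 1 : ℤ) = (m - 1 - i : ℕ) := by omega
        rw [this, zpow_natCast]
        exact abs_one_sub_pow_le hv _
    _ ≤ _ := by
        refine Finset.prod_le_prod_of_subset_of_one_le (by simpa using h.le)
          (fun _ _ => by positivity) fun i _ _ => one_le_pow₀ hv.le

lemma abs_symmQProd_le {v : ℝ} (hv : 1 < v) (M : ℕ) (j : ℤ) :
    |symmQProd v M j| ≤ v ^ j.natAbs.choose 2 := by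
  rcases Int.natAbs_eq j with h | h
  · conv_lhs => rw [h]
    exact abs_symmQProd_natCast_le hv M j.natAbs
  · conv_lhs => rw [h, symmQProd_neg]
    exact abs_symmQProd_natCast_le hv M j.natAbs

lemma exists_tendsto_symmQProd_zero {v : ℝ} (hv : 1 < v) :
    ∃ c : ℝ, c ≠ 0 ∧ Filter.Tendsto (fun M => symmQProd v M 0) Filter.atTop (nhds c) := by
  have hv0 : 0 ≤ v⁻¹ := by positivity
  have hv1 : v⁻¹ < 1 := inv_lt_one_of_one_lt₀ hv
  have hs : Summable fun i : ℕ => ‖-(v⁻¹ ^ (i + 1))‖ := by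
    simp_rw [norm_neg, norm_pow, pow_succ]
    exact (summable_geometric_of_lt_one (norm_nonneg _)
      (by rwa [Real.norm_of_nonneg hv0])).mul_right _
  have hne : ∀ i : ℕ, 1 + -(v⁻¹ ^ (i + 1)) ≠ 0 := fun i => by
    have : v⁻¹ ^ (i + 1) < 1 := pow_lt_one₀ hv0 hv1 (by omega)
    linarith
  have ht := (multipliable_one_add_of_summable hs).hasProd.tendsto_prod_nat
  refine ⟨_, pow_ne_zero 2 (tprod_one_add_ne_zero_of_summable hne hs), (ht.pow 2).congr fun M => ?_⟩
  rw [symmQProd, ← Finset.prod_pow]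
  refine Finset.prod_congr rfl fun i _ => ?_
  have : v ^ (-((i : ℤ) + 1)) = v⁻¹ ^ (i + 1) := by
    rw [zpow_neg, inv_pow]; norm_cast
  rw [neg_zero, zero_sub, this]; ring

lemma hasSum_mul_zpow_mul_symmQProd {v : ℝ} (hv : 1 < v) {d : ℤ → ℂ}
    (h : ∀ k : ℤ, HasSum (fun j => d j * (v : ℂ) ^ (j * k)) 0) (M : ℕ) (k : ℤ) :
    HasSum (fun j => d j * (v : ℂ) ^ (j * k) * symmQProd v M j) 0 := by
  have hv0 : (v : ℂ) ≠ 0 := by exact_mod_cast (by linarith : v ≠ 0)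
  induction M generalizing k with
  | zero => simpa [symmQProd] using h k
  | succ M ih =>
    have := ((ih k).mul_left (1 + (v : ℂ) ^ (-2 * (M + 1 : ℤ)))).sub
      (((ih (k + 1)).add (ih (k - 1))).mul_left ((v : ℂ) ^ (-(M + 1 : ℤ))))
    simp only [mul_zero, add_zero, sub_zero] at this
    convert! this using 2 with j
    have h1 : (v : ℂ) ^ (-2 * (M + 1 : ℤ)) =
        (v : ℂ) ^ (-(M + 1 : ℤ)) * (v : ℂ) ^ (-(M + 1 : ℤ)) := by
      rw [← zpow_add₀ hv0]; ring_nf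
    have h2 : (v : ℂ) ^ (j * (k + 1)) = (v : ℂ) ^ (j * k) * (v : ℂ) ^ j := by
      rw [← zpow_add₀ hv0]; ring_nf
    have h3 : (v : ℂ) ^ (j * (k - 1)) = (v : ℂ) ^ (j * k) * (v : ℂ) ^ (-j) := by
      rw [← zpow_add₀ hv0]; ring_nf
    have h4 : (v : ℂ) ^ j * (v : ℂ) ^ (-j) = 1 := by
      rw [← zpow_add₀ hv0]; simp
    rw [symmQProd, Finset.prod_range_succ, ← symmQProd, h1, h2, h3]
    push_cast
    rw [sub_eq_add_neg j, sub_eq_add_neg (-j), zpow_add₀ hv0, zpow_add₀ hv0]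
    linear_combination d j * (v : ℂ) ^ (j * k) * symmQProd v M j * (v : ℂ) ^ (-(M + 1 : ℤ)) *
      (v : ℂ) ^ (-(M + 1 : ℤ)) * h4

/-- A `q`-analogue of the fact that exponential sums vanishing at all integers vanish. -/
theorem eq_zero_of_hasSum_mul_zpow {v : ℝ} (hv : 1 < v) {d : ℤ → ℂ}
    (hd : Summable fun j => ‖d j‖ * v ^ j.natAbs.choose 2)
    (h : ∀ k : ℤ, HasSum (fun j => d j * (v : ℂ) ^ (j * k)) 0) : d 0 = 0 := by
  obtain ⟨c, hc, ht⟩ := exists_tendsto_symmQProd_zero hv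
  have h0 : ∀ M, ∑' j, d j * symmQProd v M j = 0 := fun M => by
    simpa using (hasSum_mul_zpow_mul_symmQProd hv h M 0).tsum_eq
  have hlim : Filter.Tendsto (fun M => ∑' j, d j * symmQProd v M j) Filter.atTop
      (nhds (∑' j : ℤ, if j = 0 then d 0 * c else 0)) := by
    refine tendsto_tsum_of_dominated_convergence 
      (f := fun M j => d j * (symmQProd v M j : ℂ)) hd (fun j => ?_)
      (Filter.Eventually.of_forall fun M j => ?_)
    · rcases eq_or_ne j 0 with rfl | hj
      · simpa using Filter.Tendsto.const_mul (d 0) ((Complex.continuous_ofReal.tendsto _).comp ht)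
      · rw [if_neg hj]
        refine tendsto_const_nhds.congr' ?_
        filter_upwards [Filter.eventually_ge_atTop j.natAbs] with M hM
        rw [symmQProd_eq_zero v hj hM]; simp
    · rw [norm_mul, Complex.norm_real]
      exact mul_le_mul_of_nonneg_left (abs_symmQProd_le hv M j) (norm_nonneg _)
  simp_rw [h0, tsum_ite_eq] at hlim
  have := tendsto_nhds_unique hlim tendsto_const_nhds
  exact (mul_eq_zero.mp this).resolve_right (by exact_mod_cast hc)

lemma summable_exp_neg_mul_sq_add_mul_abs {a : ℝ} (ha : 0 < a) (b : ℝ) :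
    Summable fun j : ℤ => Real.exp (-a * (j : ℝ) ^ 2 + b * |(j : ℝ)|) := by
  refine (summable_pow_mul_jacobiTheta₂_term_bound (b / (2 * π)) (T := a / π)
    (by positivity) 0).congr fun j => ?_
  rw [pow_zero, one_mul, Int.cast_abs]
  congr 1
  field_simp
  ring

lemma summable_exp_neg_mul_add_sq_mul_exp {a T : ℝ} (ha : 0 < a) (hT : 0 < T) (y b : ℝ) :
    Summable fun j : ℤ => Real.exp (-a * (j * T + y) ^ 2) * Real.exp (b * |(j : ℝ)|) := by
  refine (summable_exp_neg_mul_sq_add_mul_abs (a := a * T ^ 2) (by positivity)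
    (2 * a * T * |y| + b)).of_nonneg_of_le (fun _ => by positivity) fun j => ?_
  rw [← Real.exp_add, Real.exp_le_exp]
  have h1 : -((j : ℝ) * y) ≤ |(j : ℝ)| * |y| := by
    rw [← abs_mul]; exact neg_le_abs _
  have h2 := mul_le_mul_of_nonneg_left h1 (by positivity : 0 ≤ 2 * a * T)
  have h3 : 0 ≤ a * y ^ 2 := by positivity
  linarith

lemma summable_exp_neg_mul_add_sq {a T : ℝ} (ha : 0 < a) (hT : 0 < T) (y : ℝ) :
    Summable fun j : ℤ => Real.exp (-a * (j * T + y) ^ 2) := by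
  simpa using summable_exp_neg_mul_add_sq_mul_exp ha hT y 0

lemma summable_exp_neg_mul_abs_int {a : ℝ} (ha : 0 < a) :
    Summable fun j : ℤ => Real.exp (-a * |(j : ℝ)|) := by
  have h : Summable fun j : ℕ => Real.exp (-a * |((j : ℤ) : ℝ)|) := by
    refine (Real.summable_exp_nat_mul_iff.mpr (neg_lt_zero.mpr ha)).congr fun j => ?_
    rw [Int.cast_natCast, Nat.abs_cast, mul_comm]
  refine Summable.of_nat_of_neg h (h.congr fun j => ?_)
  rw [Int.cast_neg, abs_neg]

lemma pow_choose_two_eq_exp (s : ℝ) (j : ℤ) :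
    Real.exp (2 * s) ^ j.natAbs.choose 2 = Real.exp (s * ((j : ℝ) ^ 2 - |(j : ℝ)|)) := by
  rw [← Real.exp_nat_mul, Nat.cast_choose_two, Nat.cast_natAbs, Int.cast_abs]
  congr 1
  rw [← sq_abs (j : ℝ)]
  ring

lemma summable_gaussian_mul_pow_choose_two {α T y : ℝ} (hα : 0 < α)
    (h : α < T ∨ α = T ∧ y = 0) :
    Summable fun j : ℤ => Real.exp (-π * (j * T) ^ 2 - 2 * π * (j * T) * y) *
      Real.exp (2 * (π * T * α)) ^ j.natAbs.choose 2 := by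
  simp_rw [pow_choose_two_eq_exp, ← Real.exp_add]
  rcases h with h | ⟨rfl, rfl⟩
  · have hT : 0 < T := hα.trans h
    refine (summable_exp_neg_mul_sq_add_mul_abs (a := π * (T * (T - α)))
      (mul_pos pi_pos (mul_pos hT (by linarith))) (2 * π * T * |y|)).of_nonneg_of_le
      (fun _ => (Real.exp_pos _).le) fun j => Real.exp_le_exp.mpr ?_
    have h1 : -((j : ℝ) * y) ≤ |(j : ℝ)| * |y| := by
      rw [← abs_mul]; exact neg_le_abs _
    have h2 : 0 ≤ π * T * α * |(j : ℝ)| := by positivity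
    have h3 := mul_le_mul_of_nonneg_left h1 (by positivity : 0 ≤ 2 * π * T)
    linarith
  · refine (summable_exp_neg_mul_abs_int (a := π * α * α) (by positivity)).congr fun j => ?_
    congr 1; ring

lemma eq_zero_of_tsum_mul_gaussian_eq_zero_aux {α T y C : ℝ} (hα : 0 < α)
    (h : α < T ∨ α = T ∧ y = 0) {c : ℤ → ℂ} (hc : ∀ j, ‖c j‖ ≤ C)
    (h0 : ∀ k : ℤ, ∑' j : ℤ, c j * (Real.exp (-π * (j * T + y - α * k) ^ 2) : ℝ) = 0) :
    c 0 = 0 := by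
  have hT : 0 < T := by rcases h with h | h <;> linarith
  have hC : 0 ≤ C := (norm_nonneg _).trans (hc 0)
  set s := π * T * α with hs
  set d : ℤ → ℂ := fun j => c j * (Real.exp (-π * (j * T) ^ 2 - 2 * π * (j * T) * y) : ℝ) with hd
  have key : ∀ k j : ℤ, c j * (Real.exp (-π * (j * T + y - α * k) ^ 2) : ℝ) =
      d j * ((Real.exp (2 * s) : ℝ) : ℂ) ^ (j * k) * (Real.exp (-π * (y - α * k) ^ 2) : ℝ) := by
    intro k j
    rw [hd]
    simp only [mul_assoc]
    rw [← Complex.ofReal_zpow, ← Real.rpow_intCast, ← Real.exp_mul, ← Complex.ofReal_mul,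
      ← Complex.ofReal_mul,
      ← Real.exp_add, ← Real.exp_add]
    congr 4
    push_cast
    rw [hs]; ring
  have hsum : ∀ k : ℤ, Summable fun j : ℤ =>
      c j * (Real.exp (-π * (j * T + y - α * k) ^ 2) : ℝ) := by
    intro k
    refine Summable.of_norm_bounded (g := fun j : ℤ => C * Real.exp (-π * (j * T + y - α * k) ^ 2))
      (Summable.mul_left _ ?_) fun j => ?_
    · simpa only [add_sub_assoc] using summable_exp_neg_mul_add_sq pi_pos hT (y - α * k)
    · rw [norm_mul, Complex.norm_real, Real.norm_of_nonneg (Real.exp_pos _).le]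
      exact mul_le_mul_of_nonneg_right (hc j) (Real.exp_pos _).le
  have hd0 : d 0 = 0 := by
    refine eq_zero_of_hasSum_mul_zpow (v := Real.exp (2 * s)) ?_ ?_ fun k => ?_
    · rw [Real.one_lt_exp_iff]; positivity
    · refine ((summable_gaussian_mul_pow_choose_two hα h).mul_left C).of_nonneg_of_le
        (fun _ => by positivity) fun j => ?_
      rw [← mul_assoc C]
      refine mul_le_mul_of_nonneg_right ?_ (pow_nonneg (Real.exp_pos _).le _)
      rw [hd, norm_mul, Complex.norm_real, Real.norm_of_nonneg (Real.exp_pos _).le]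
      exact mul_le_mul_of_nonneg_right (hc j) (Real.exp_pos _).le
    · have h1 : HasSum (fun j : ℤ => c j * (Real.exp (-π * (j * T + y - α * k) ^ 2) : ℝ)) 0 := by
        simpa only [h0 k] using (hsum k).hasSum
      simp_rw [key k] at h1
      have hne : ((Real.exp (-π * (y - α * k) ^ 2) : ℝ) : ℂ) ≠ 0 := by
        exact_mod_cast (Real.exp_pos _).ne'
      have h2 := h1.mul_right ((Real.exp (-π * (y - α * k) ^ 2) : ℝ) : ℂ)⁻¹
      simpa only [zero_mul, mul_inv_cancel_right₀ hne] using h2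
  simpa [hd] using hd0

/-- A bounded sequence annihilating all translates of the Gaussian by a lattice which is at least
as dense as the lattice of sampling points vanishes. -/
theorem eq_zero_of_tsum_mul_gaussian_eq_zero {α T C : ℝ} (hα : 0 < α) (hαT : α ≤ T)
    {c : ℤ → ℂ} (hc : ∀ j, ‖c j‖ ≤ C)
    (h0 : ∀ k : ℤ, ∑' j : ℤ, c j * (Real.exp (-π * (j * T - α * k) ^ 2) : ℝ) = 0) : c = 0 := by
  funext i
  have shift : ∀ k k₀ : ℤ, ∑' j : ℤ, c (j + i) *
      (Real.exp (-π * (j * T + (i * T - α * k₀) - α * k) ^ 2) : ℝ) = 0 := by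
    intro k k₀
    rw [← h0 (k + k₀), ← (Equiv.addRight i).tsum_eq
      (fun j : ℤ => c j * (Real.exp (-π * (j * T - α * (k + k₀ : ℤ)) ^ 2) : ℝ))]
    refine tsum_congr fun j => ?_
    simp only [Equiv.coe_addRight]
    congr 5
    push_cast
    ring
  have : c (0 + i) = 0 := by
    rcases hαT.lt_or_eq with h | rfl
    · exact eq_zero_of_tsum_mul_gaussian_eq_zero_aux hα (c := fun j => c (j + i)) (Or.inl h)
        (fun j => hc _) (fun k => shift k 0)
    · exact eq_zero_of_tsum_mul_gaussian_eq_zero_aux hα (c := fun j => c (j + i))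
        (Or.inr ⟨rfl, by ring⟩) (fun j => hc _) (fun k => shift k i)
  simpa using this

lemma tsum_int_eq_sum_tsum_mul_add {p : ℕ} [NeZero p] {F : ℤ → ℂ} (hF : Summable F) :
    ∑' j, F j = ∑ t : Fin p, ∑' s : ℤ, F (s * p + (t : ℕ)) := by
  set e : Fin p × ℤ ≃ ℤ := (Equiv.prodComm (Fin p) ℤ).trans (Int.divModEquiv p).symm with he
  have h1 : Summable fun x => F (e x) := e.summable_iff.mpr hF
  rw [← e.tsum_eq F, h1.tsum_prod, tsum_fintype]
  rfl

/-- The Gaussian analogue of the Zak matrix can be inverted from the left by a finitely supported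
family of translates. -/
theorem exists_finsupp_sum_mul_tsum_gaussian_eq {α T : ℝ} (hα : 0 < α) (hαT : α ≤ T)
    (p : ℕ) [NeZero p] (i : Fin p) :
    ∃ l : ℤ →₀ ℂ, ∀ t : Fin p, (l.sum fun k a => a * ∑' s : ℤ,
      ((Real.exp (-π * (((s * p + (t : ℕ) : ℤ) : ℝ) * T - α * k) ^ 2) : ℝ) : ℂ)) =
        if t = i then 1 else 0 := by
  set w : ℤ → Fin p → ℂ := fun k t => ∑' s : ℤ,
      ((Real.exp (-π * (((s * p + (t : ℕ) : ℤ) : ℝ) * T - α * k) ^ 2) : ℝ) : ℂ) with hw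
  have hspan : Submodule.span ℂ (Set.range w) = ⊤ := by
    by_contra hne
    obtain ⟨f, hf0, hf⟩ := Submodule.exists_le_ker_of_lt_top _ (lt_top_iff_ne_top.mpr hne)
    set u : Fin p → ℂ := fun t => f (Pi.single t 1) with hu
    have hfu : ∀ x : Fin p → ℂ, f x = ∑ t, u t * x t := fun x => by
      conv_lhs => rw [pi_eq_sum_univ' x]
      simp [hu, map_sum, map_smul, mul_comm]
    set c : ℤ → ℂ := fun j => u (Int.divModEquiv p j).2 with hc
    have hcu : ∀ (s : ℤ) (t : Fin p), c (s * p + (t : ℕ)) = u t := fun s t => by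
      have := (Int.divModEquiv p).apply_symm_apply (s, t)
      rw [Int.divModEquiv_symm_apply] at this
      simp only [hc, this]
    have hcb : ∀ j, ‖c j‖ ≤ ‖u‖ := fun j => norm_le_pi_norm u _
    have hc0 : c = 0 := by
      refine eq_zero_of_tsum_mul_gaussian_eq_zero hα hαT hcb fun k => ?_
      rw [tsum_int_eq_sum_tsum_mul_add (p := p)]
      · simp_rw [hcu, tsum_mul_left]
        rw [← hfu (w k)]
        exact hf (Submodule.subset_span ⟨k, rfl⟩)
      · refine Summable.of_norm_bounded ((summable_exp_neg_mul_add_sq pi_pos (hα.trans_le hαT)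
          (-(α * k))).mul_left ‖u‖) fun j => ?_
        rw [norm_mul, Complex.norm_real, Real.norm_of_nonneg (Real.exp_pos _).le, ← sub_eq_add_neg]
        exact mul_le_mul_of_nonneg_right (hcb j) (Real.exp_pos _).le
    refine hf0 (LinearMap.ext fun x => ?_)
    rw [hfu, LinearMap.zero_apply]
    refine Finset.sum_eq_zero fun t _ => ?_
    rw [← hcu 0 t, hc0, Pi.zero_apply, zero_mul]
  have hmem : (Pi.single i 1 : Fin p → ℂ) ∈ Submodule.span ℂ (Set.range w) := by
    rw [hspan]; trivial
  obtain ⟨l, hl⟩ := Finsupp.mem_span_range_iff_exists_finsupp.mp hmem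
  refine ⟨l, fun t => ?_⟩
  have := congrFun hl t
  rw [Pi.single_apply, Finsupp.sum, Finset.sum_apply] at this
  simpa only [Finsupp.sum, Pi.smul_apply, smul_eq_mul] using this

lemma exists_polynomial_iteratedDeriv_exp_neg_mul_sq (a : ℝ) (n : ℕ) :
    ∃ P : Polynomial ℝ, P.natDegree ≤ n ∧ P.coeff n = (-(2 * a)) ^ n ∧
      iteratedDeriv n (fun t : ℝ => Real.exp (-a * t ^ 2)) =
        fun t => P.eval t * Real.exp (-a * t ^ 2) := by
  induction n with
  | zero => exact ⟨1, by simp, by simp, by simp⟩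
  | succ n ih =>
    obtain ⟨P, hP, hc, hP'⟩ := ih
    have hd : P.derivative.natDegree ≤ n := (P.natDegree_derivative_le).trans (by omega)
    refine ⟨P.derivative + Polynomial.C (-(2 * a)) * (Polynomial.X * P), ?_, ?_, ?_⟩
    · refine Polynomial.natDegree_add_le_of_degree_le (by omega) ?_
      refine (Polynomial.natDegree_C_mul_le _ _).trans (Polynomial.natDegree_mul_le.trans ?_)
      have := Polynomial.natDegree_X_le (R := ℝ)
      omega
    · rw [Polynomial.coeff_add, Polynomial.coeff_eq_zero_of_natDegree_lt (by omega),
        Polynomial.coeff_C_mul, Polynomial.coeff_X_mul, hc, zero_add, pow_succ']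
    · rw [iteratedDeriv_succ, hP']
      funext t
      have h1 : HasDerivAt (fun t : ℝ => Real.exp (-a * t ^ 2))
          (Real.exp (-a * t ^ 2) * (-a * (2 * t))) t := by
        simpa using (((hasDerivAt_id t).pow 2).const_mul (-a)).exp
      rw [((P.hasDerivAt t).fun_mul h1).deriv]
      simp only [Polynomial.eval_add, Polynomial.eval_mul, Polynomial.eval_C, Polynomial.eval_X]
      ring

lemma exists_polynomial_hermiteFn (n : ℕ) :
    ∃ P : Polynomial ℂ, P ≠ 0 ∧
      ∀ x : ℝ, hermiteFn n x = P.eval (x : ℂ) * (Real.exp (-π * x ^ 2) : ℝ) := by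
  obtain ⟨P, -, hc, hP⟩ := exists_polynomial_iteratedDeriv_exp_neg_mul_sq (2 * π) n
  refine ⟨P.map Complex.ofRealHom, ?_, fun x => ?_⟩
  · rw [Ne, Polynomial.map_eq_zero]
    rintro rfl
    rw [Polynomial.coeff_zero] at hc
    exact pow_ne_zero n (by have := pi_pos; linarith) hc.symm
  · have h1 : Real.exp (π * x ^ 2) * Real.exp (-(2 * π) * x ^ 2) = Real.exp (-π * x ^ 2) := by
      rw [← Real.exp_add]; congr 1; ring
    have h2 : (P.map Complex.ofRealHom).eval (x : ℂ) = (P.eval x : ℝ) :=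
      Polynomial.eval_map_apply (f := Complex.ofRealHom) x
    rw [h2, hermiteFn, hP, ← h1]
    push_cast
    ring

lemma exists_abs_pow_mul_exp_le (m : ℕ) :
    ∃ K : ℝ, ∀ y : ℝ, |y| ^ m * Real.exp (-π * y ^ 2) ≤ K * Real.exp (-(π / 2) * y ^ 2) := by
  refine ⟨m.factorial * Real.exp 1, fun y => ?_⟩
  have h1 : |y| ^ m ≤ m.factorial * Real.exp |y| := by
    have := Real.pow_div_factorial_le_exp |y| (abs_nonneg y) m
    rwa [div_le_iff₀' (by positivity)] at this
  have h2 : |y| ≤ 1 + π / 2 * y ^ 2 := by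
    have := pi_gt_three
    nlinarith [sq_nonneg (|y| - 1), sq_abs y, sq_nonneg y]
  calc |y| ^ m * Real.exp (-π * y ^ 2)
      ≤ m.factorial * Real.exp |y| * Real.exp (-π * y ^ 2) := by gcongr
    _ ≤ m.factorial * Real.exp (1 + π / 2 * y ^ 2) * Real.exp (-π * y ^ 2) := by gcongr
    _ = m.factorial * Real.exp 1 * Real.exp (-(π / 2) * y ^ 2) := by
        rw [mul_assoc, mul_assoc, ← Real.exp_add, ← Real.exp_add]
        congr 2; ring

lemma exists_norm_eval_mul_exp_le (P : Polynomial ℂ) :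
    ∃ K : ℝ, ∀ y : ℝ, ‖P.eval (y : ℂ) * (Real.exp (-π * y ^ 2) : ℝ)‖ ≤
      K * Real.exp (-(π / 2) * y ^ 2) := by
  induction P using Polynomial.induction_on' with
  | add P Q hP hQ =>
    obtain ⟨K, hK⟩ := hP
    obtain ⟨L, hL⟩ := hQ
    refine ⟨K + L, fun y => ?_⟩
    rw [Polynomial.eval_add, add_mul, add_mul]
    exact (norm_add_le _ _).trans (add_le_add (hK y) (hL y))
  | monomial m a =>
    obtain ⟨K, hK⟩ := exists_abs_pow_mul_exp_le m
    refine ⟨‖a‖ * K, fun y => ?_⟩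
    rw [Polynomial.eval_monomial, mul_assoc, norm_mul, mul_assoc, norm_mul, norm_pow,
      Complex.norm_real, Complex.norm_real, Real.norm_of_nonneg (Real.exp_pos _).le,
      Real.norm_eq_abs]
    exact mul_le_mul_of_nonneg_left (hK y) (norm_nonneg a)

/-- The Zak transform of `g` with step `L`, with complex frequency. -/
noncomputable def zak (g : ℝ → ℂ) (L y : ℝ) (ζ : ℂ) : ℂ :=
  ∑' s : ℤ, g (y + s * L) * cexp (2 * π * I * s * ζ)

lemma differentiable_zak {g : ℝ → ℂ} {K a L : ℝ} (ha : 0 < a) (hL : 0 < L)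
    (hg : ∀ y, ‖g y‖ ≤ K * Real.exp (-a * y ^ 2)) (y : ℝ) : Differentiable ℂ (zak g L y) := by
  intro ζ
  have h : DifferentiableOn ℂ (zak g L y) (Metric.ball 0 (‖ζ‖ + 1)) := by
    refine differentiableOn_tsum_of_summable_norm
      (u := fun s : ℤ => K * (Real.exp (-a * (s * L + y) ^ 2) *
        Real.exp (2 * π * (‖ζ‖ + 1) * |(s : ℝ)|)))
      ((summable_exp_neg_mul_add_sq_mul_exp ha hL y _).mul_left K) (fun s => by fun_prop)
      Metric.isOpen_ball fun s w hw => ?_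
    rw [mem_ball_zero_iff] at hw
    rw [norm_mul, ← mul_assoc, Complex.norm_exp, add_comm (s * L : ℝ)]
    refine mul_le_mul (hg _) (Real.exp_le_exp.mpr ?_) (Real.exp_pos _).le
      ((norm_nonneg _).trans (hg _))
    calc (2 * π * I * s * w).re ≤ ‖2 * π * I * s * w‖ := Complex.re_le_norm _
      _ = 2 * π * |(s : ℝ)| * ‖w‖ := by
        simp [abs_of_pos pi_pos]
      _ ≤ 2 * π * |(s : ℝ)| * (‖ζ‖ + 1) := by gcongr
      _ = _ := by ring
  exact h.differentiableAt (Metric.isOpen_ball.mem_nhds (by simp))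

lemma zak_polynomial_mul_gaussian (P : Polynomial ℂ) (L x y : ℝ) :
    zak (fun z => P.eval (z : ℂ) * (Real.exp (-π * z ^ 2) : ℝ)) L (x + y) (-(x * L * I)) =
      (Real.exp (-π * x ^ 2 - 2 * π * x * y) : ℝ) *
        ∑' s : ℤ, P.eval ((x : ℂ) + (y + s * L : ℝ)) * (Real.exp (-π * (y + s * L) ^ 2) : ℝ) := by
  rw [zak, ← tsum_mul_left]
  refine tsum_congr fun s => ?_
  have h1 : cexp (2 * π * I * s * -(x * L * I)) = (Real.exp (2 * π * s * x * L) : ℝ) := by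
    push_cast
    congr 1
    linear_combination (-2 * π * s * x * L : ℂ) * I_mul_I
  have h2 : Real.exp (-π * (x + y + s * L) ^ 2) * Real.exp (2 * π * s * x * L) =
      Real.exp (-π * x ^ 2 - 2 * π * x * y) * Real.exp (-π * (y + s * L) ^ 2) := by
    rw [← Real.exp_add, ← Real.exp_add]; congr 1; ring
  rw [h1, mul_assoc, ← Complex.ofReal_mul, h2, add_assoc]
  push_cast
  ring

lemma summable_eval_mul_gaussian (P : Polynomial ℂ) {L : ℝ} (hL : 0 < L) (y : ℝ) :
    Summable fun s : ℤ => P.eval (((y + s * L : ℝ)) : ℂ) *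
      (Real.exp (-π * (y + s * L) ^ 2) : ℝ) := by
  obtain ⟨K, hK⟩ := exists_norm_eval_mul_exp_le P
  refine Summable.of_norm_bounded
    ((summable_exp_neg_mul_add_sq (half_pos pi_pos) hL y).mul_left K) fun s => ?_
  rw [add_comm (s * L : ℝ)]
  exact hK _

lemma tsum_eval_add_mul_gaussian (P : Polynomial ℂ) {L : ℝ} (hL : 0 < L) (x : ℂ) (y : ℝ) :
    ∑' s : ℤ, P.eval (x + (y + s * L : ℝ)) * (Real.exp (-π * (y + s * L) ^ 2) : ℝ) =
      ∑ m ∈ Finset.range (P.natDegree + 1), x ^ m * ∑' s : ℤ,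
        (P.hasseDeriv m).eval (((y + s * L : ℝ)) : ℂ) * (Real.exp (-π * (y + s * L) ^ 2) : ℝ) := by
  simp_rw [← tsum_mul_left]
  rw [← Summable.tsum_finsetSum fun m _ => (summable_eval_mul_gaussian _ hL y).mul_left _]
  refine tsum_congr fun s => ?_
  rw [← Polynomial.taylor_eval, Polynomial.eval_eq_sum_range,
    Polynomial.natDegree_taylor, Finset.sum_mul]
  refine Finset.sum_congr rfl fun m _ => ?_
  rw [Polynomial.taylor_coeff]
  ring

lemma finite_setOf_det_sum_pow_smul_eq_zero {ι : Type*} [Fintype ι] [DecidableEq ι] (n : ℕ)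
    (E : ℕ → Matrix ι ι ℂ) {a : ℂ} (ha : a ≠ 0) (hE : E n = a • 1) :
    {x : ℝ | (∑ m ∈ Finset.range (n + 1), (x : ℂ) ^ m • E m).det = 0}.Finite := by
  set M : Matrix ι ι (Polynomial ℂ) := ∑ m ∈ Finset.range (n + 1),
    (Polynomial.X ^ (n - m) : Polynomial ℂ) • (E m).map Polynomial.C with hM
  have heval : ∀ y : ℂ, M.det.eval y =
      (∑ m ∈ Finset.range (n + 1), y ^ (n - m) • E m).det := fun y => by
    rw [← Polynomial.coe_evalRingHom, RingHom.map_det]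
    congr 1
    ext i j
    simp only [hM, RingHom.mapMatrix_apply, Matrix.map_apply, Matrix.sum_apply, Matrix.smul_apply,
      smul_eq_mul, Polynomial.coe_evalRingHom, Polynomial.eval_finsetSum, Polynomial.eval_mul,
      Polynomial.eval_pow, Polynomial.eval_X, Polynomial.eval_C]
  have hM0 : M.det ≠ 0 := by
    intro h
    have h0 := heval 0
    rw [h, Polynomial.eval_zero, Finset.sum_range_succ, Finset.sum_eq_zero, hE] at h0
    · rw [Nat.sub_self, pow_zero, one_smul, zero_add, Matrix.det_smul, Matrix.det_one,
        mul_one] at h0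
      exact pow_ne_zero _ ha h0.symm
    · intro m hm
      rw [Finset.mem_range] at hm
      rw [zero_pow (by omega), zero_smul]
  have hfin : {y : ℂ | M.det.IsRoot y}.Finite := Polynomial.finite_setOfPred_isRoot hM0
  refine ((hfin.preimage (f := fun x : ℝ => (x : ℂ)⁻¹) ?_).union (Set.finite_singleton 0)).subset
    fun x hx => ?_
  · exact (inv_injective.comp Complex.ofReal_injective).injOn
  · by_cases hx0 : x = 0
    · exact Or.inr hx0
    refine Or.inl ?_
    have hxc : (x : ℂ) ≠ 0 := by exact_mod_cast hx0
    have h1 : ∑ m ∈ Finset.range (n + 1), ((x : ℂ)⁻¹) ^ (n - m) • E m =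
        ((x : ℂ)⁻¹) ^ n • ∑ m ∈ Finset.range (n + 1), (x : ℂ) ^ m • E m := by
      rw [Finset.smul_sum]
      refine Finset.sum_congr rfl fun m hm => ?_
      rw [Finset.mem_range] at hm
      rw [smul_smul, inv_pow, inv_pow, ← Nat.sub_add_cancel (Nat.lt_succ_iff.mp hm), pow_add]
      congr 1
      simp only [Nat.add_sub_cancel]
      field_simp
    rw [Set.mem_preimage, Set.mem_ofPred_eq, Polynomial.IsRoot.def, heval, h1, Matrix.det_smul,
      Set.mem_ofPred_eq.mp hx, mul_zero]

/-- The Zak matrix of `g`, multiplied on the left by the matrix of coefficients `l`. -/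
noncomputable def zakMatrix (g : ℝ → ℂ) (α T : ℝ) (p : ℕ) (l : Fin p → ℤ →₀ ℂ) (x : ℝ) (ζ : ℂ) :
    Matrix (Fin p) (Fin p) ℂ :=
  Matrix.of fun i t => (l i).sum fun k a => a * (Real.exp (-2 * π * x * (α * k)) : ℝ) *
    zak g (p * T) (x + ((t : ℕ) * T - α * k)) ζ

lemma zakMatrix_polynomial_mul_gaussian (P : Polynomial ℂ) {α T : ℝ} (hT : 0 < T)
    (p : ℕ) [NeZero p] (l : Fin p → ℤ →₀ ℂ) (x : ℝ) :
    zakMatrix (fun z => P.eval (z : ℂ) * (Real.exp (-π * z ^ 2) : ℝ)) α T p l x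
        (-(x * (p * T : ℝ) * I)) =
      (∑ m ∈ Finset.range (P.natDegree + 1), (x : ℂ) ^ m • Matrix.of fun i t : Fin p =>
        (l i).sum fun k a => a * ∑' s : ℤ, (P.hasseDeriv m).eval
          ((((s * p + (t : ℕ) : ℤ) : ℝ) * T - α * k : ℝ) : ℂ) *
          (Real.exp (-π * (((s * p + (t : ℕ) : ℤ) : ℝ) * T - α * k) ^ 2) : ℝ)) *
      Matrix.diagonal fun t : Fin p =>
        ((Real.exp (-π * x ^ 2 - 2 * π * x * ((t : ℕ) * T)) : ℝ) : ℂ) := by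
  have hp : (0 : ℝ) < p := by exact_mod_cast Nat.pos_of_ne_zero (NeZero.ne p)
  ext i t
  rw [Matrix.mul_diagonal, Matrix.sum_apply]
  simp only [zakMatrix, Matrix.of_apply, Matrix.smul_apply, smul_eq_mul, Finsupp.sum,
    zak_polynomial_mul_gaussian, tsum_eval_add_mul_gaussian P (mul_pos hp hT)]
  have h1 : ∀ (s k : ℤ), (((s * p + (t : ℕ) : ℤ) : ℝ) * T - α * k) =
      ((t : ℕ) * T - α * k) + s * (p * T) := fun s k => by push_cast; ring
  simp_rw [h1, Finset.mul_sum, Finset.sum_mul]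
  rw [Finset.sum_comm]
  refine Finset.sum_congr rfl fun m _ => Finset.sum_congr rfl fun k _ => ?_
  have h2 : Real.exp (-2 * π * x * (α * k)) *
      Real.exp (-π * x ^ 2 - 2 * π * x * ((t : ℕ) * T - α * k)) =
      Real.exp (-π * x ^ 2 - 2 * π * x * ((t : ℕ) * T)) := by
    rw [← Real.exp_add]; congr 1; ring
  rw [← h2]
  push_cast
  ring

lemma differentiable_det {ι : Type*} [Fintype ι] [DecidableEq ι] {A : ℂ → Matrix ι ι ℂ}
    (hA : ∀ i j, Differentiable ℂ fun z => A z i j) : Differentiable ℂ fun z => (A z).det := by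
  simp_rw [Matrix.det_apply]
  fun_prop

lemma countable_setOf_ofReal_eq_zero {f : ℂ → ℂ} (hf : Differentiable ℂ f) {w : ℂ}
    (hw : f w ≠ 0) : {ξ : ℝ | f ξ = 0}.Countable := by
  have hcod := (hf.differentiableOn.analyticOnNhd isOpen_univ).preimage_zero_mem_codiscrete hw
  have hcount : (f ⁻¹' {0}ᶜ)ᶜ.Countable :=
    (HereditarilyLindelofSpace.isLindelof _).countable_of_isDiscrete (mem_codiscrete'.mp hcod).2
  rw [← Set.preimage_compl, compl_compl] at hcount
  exact hcount.preimage Complex.ofReal_injective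

theorem exists_finsupp_zakMatrix {P : Polynomial ℂ} (hP : P ≠ 0) {α T : ℝ} (hα : 0 < α)
    (hαT : α ≤ T) (p : ℕ) [NeZero p] :
    ∃ l : Fin p → ℤ →₀ ℂ, {x : ℝ | ¬ {ξ : ℝ | (zakMatrix
      (fun z => P.eval (z : ℂ) * (Real.exp (-π * z ^ 2) : ℝ)) α T p l x ξ).det = 0}.Countable
      }.Finite := by
  have hT := hα.trans_le hαT
  have hp : (0 : ℝ) < p := by exact_mod_cast Nat.pos_of_ne_zero (NeZero.ne p)
  choose l hl using exists_finsupp_sum_mul_tsum_gaussian_eq hα hαT p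
  refine ⟨l, (finite_setOf_det_sum_pow_smul_eq_zero P.natDegree (fun m => Matrix.of fun i t =>
    (l i).sum fun k a => a * ∑' s : ℤ, (P.hasseDeriv m).eval
      ((((s * p + (t : ℕ) : ℤ) : ℝ) * T - α * k : ℝ) : ℂ) *
      (Real.exp (-π * (((s * p + (t : ℕ) : ℤ) : ℝ) * T - α * k) ^ 2) : ℝ))
    (Polynomial.leadingCoeff_ne_zero.mpr hP) ?_).subset fun x hx => ?_⟩
  · ext i t
    simp only [Matrix.of_apply, Polynomial.hasseDeriv_natDegree_eq_C, Polynomial.eval_C,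
      tsum_mul_left, Matrix.smul_apply, Matrix.one_apply, smul_eq_mul]
    simp_rw [eq_comm (a := i), ← hl i t, Finsupp.sum, Finset.mul_sum]
    exact Finset.sum_congr rfl fun k _ => by ring
  · contrapose! hx
    obtain ⟨K, hK⟩ := exists_norm_eval_mul_exp_le P
    refine not_not.mpr (countable_setOf_ofReal_eq_zero (w := -(x * (p * T : ℝ) * I))
      (differentiable_det fun i t => ?_) ?_)
    · simp only [zakMatrix, Matrix.of_apply, Finsupp.sum]
      have := fun y => differentiable_zak (half_pos pi_pos) (mul_pos hp hT) hK y
      fun_prop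
    · rw [zakMatrix_polynomial_mul_gaussian P hT, Matrix.det_mul, Matrix.det_diagonal]
      refine mul_ne_zero hx (Finset.prod_ne_zero_iff.mpr fun t _ => ?_)
      exact_mod_cast (Real.exp_pos _).ne'

lemma exists_fourierCoeff_eq {T : ℝ} [hT : Fact (0 < T)] {c : ℤ → ℂ} (hc : Memℓp c 2) :
    ∃ h : AddCircle T → ℂ, Integrable h AddCircle.haarAddCircle ∧ ∀ n, fourierCoeff h n = c n := by
  refine ⟨(fourierBasis (T := T)).repr.symm ⟨c, hc⟩,
    (Lp.memLp _).integrable (by norm_num), fun n => ?_⟩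
  rw [← fourierBasis_repr, LinearIsometryEquiv.apply_symm_apply]

lemma continuous_tsum_mul_fourier_neg {T : ℝ} [hT : Fact (0 < T)] {b : ℤ → ℂ}
    (hb : Summable fun s => ‖b s‖) :
    Continuous fun z : AddCircle T => ∑' s : ℤ, b s * fourier (-s) z := by
  refine continuous_tsum (fun s => by fun_prop) hb fun s z => ?_
  rw [norm_mul]
  exact mul_le_of_le_one_right (norm_nonneg _)
    (((fourier (-s)).norm_coe_le_norm z).trans (fourier_norm (-s)).le)

lemma norm_fourier_apply {T : ℝ} (n : ℤ) (z : AddCircle T) : ‖fourier n z‖ = 1 := by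
  rw [fourier_apply, Circle.norm_coe]

lemma integrable_mul_tsum_mul_fourier_neg {T : ℝ} [hT : Fact (0 < T)] {b : ℤ → ℂ}
    (hb : Summable fun s => ‖b s‖) {h : AddCircle T → ℂ}
    (hh : Integrable h AddCircle.haarAddCircle) :
    Integrable (fun z => (∑' s : ℤ, b s * fourier (-s) z) * h z) AddCircle.haarAddCircle := by
  have hcont := continuous_tsum_mul_fourier_neg (T := T) hb
  obtain ⟨C, hC⟩ := isCompact_univ.exists_bound_of_continuousOn hcont.continuousOn
  exact hh.bdd_mul hcont.aestronglyMeasurable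
    (Filter.Eventually.of_forall fun z => hC z (Set.mem_univ z))

lemma fourierCoeff_tsum_mul_fourier_neg_mul {T : ℝ} [hT : Fact (0 < T)] {b : ℤ → ℂ}
    (hb : Summable fun s => ‖b s‖) {h : AddCircle T → ℂ}
    (hh : Integrable h AddCircle.haarAddCircle) (m : ℤ) :
    fourierCoeff (fun z => (∑' s : ℤ, b s * fourier (-s) z) * h z) m =
      ∑' s : ℤ, b s * fourierCoeff h (m + s) := by
  have hInt : ∀ n : ℤ, Integrable (fun z => fourier n z * h z) AddCircle.haarAddCircle :=
    fun n => hh.bdd_mul (c := 1) (fourier n).continuous.aestronglyMeasurable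
      (Filter.Eventually.of_forall fun z => (norm_fourier_apply n z).le)
  have hF : ∀ s : ℤ, Integrable (fun z => b s * (fourier (-(m + s)) z * h z))
      AddCircle.haarAddCircle := fun s => (hInt _).const_mul _
  have hsum : Summable fun s : ℤ => ∫ z, ‖b s * (fourier (-(m + s)) z * h z)‖
      ∂AddCircle.haarAddCircle := by
    simp_rw [norm_mul, norm_fourier_apply, one_mul, integral_const_mul]
    exact hb.mul_right _
  have key := integral_tsum_of_summable_integral_norm hF hsum
  simp_rw [integral_const_mul] at key
  simp only [fourierCoeff, smul_eq_mul]
  rw [key]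
  refine integral_congr_ae (Filter.Eventually.of_forall fun z => ?_)
  simp only
  rw [← mul_assoc, ← tsum_mul_left, ← tsum_mul_right]
  refine tsum_congr fun s => ?_
  rw [neg_add, fourier_add]
  ring

lemma tsum_fourier_eq_zak (g : ℝ → ℂ) (L y ξ : ℝ) :
    ∑' s : ℤ, g (y + s * L) * fourier (-s) (ξ : AddCircle (1 : ℝ)) = zak g L y ((-ξ : ℝ) : ℂ) := by
  refine tsum_congr fun s => ?_
  rw [fourier_coe_apply]
  congr 2
  push_cast
  ring

/-- If the Zak matrix is almost everywhere invertible, an `ℓ²` sequence annihilating the samples of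
all translates of `g` vanishes. -/
theorem eq_zero_of_tsum_mul_translate_eq_zero {g : ℝ → ℂ} {K a α T : ℝ} {p q : ℕ} [NeZero p]
    (ha : 0 < a) (hT : 0 < T) (hg : ∀ y, ‖g y‖ ≤ K * Real.exp (-a * y ^ 2))
    (hpq : α * q = p * T) {l : Fin p → ℤ →₀ ℂ} {x : ℝ}
    (hx : {ξ : ℝ | (zakMatrix g α T p l x ξ).det = 0}.Countable) {c : ℤ → ℂ} (hc : Memℓp c 2)
    (h0 : ∀ k : ℤ, ∑' j : ℤ, c j * g (x + j * T - α * k) = 0) : c = 0 := by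
  have : Fact ((0 : ℝ) < 1) := ⟨one_pos⟩
  have hp : (0 : ℝ) < p := by exact_mod_cast Nat.pos_of_ne_zero (NeZero.ne p)
  have hgsum : ∀ {L : ℝ}, 0 < L → ∀ y, Summable fun s : ℤ => ‖g (y + s * L)‖ := fun {L} hL y => by
    refine ((summable_exp_neg_mul_add_sq ha hL y).mul_left K).of_nonneg_of_le
      (fun _ => norm_nonneg _) fun s => ?_
    rw [add_comm (s * L)]
    exact hg _
  have hct : ∀ t : Fin p, Memℓp (fun s : ℤ => c (s * p + (t : ℕ))) 2 := fun t => by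
    have h2 : (0 : ℝ) < (2 : ENNReal).toReal := by norm_num
    refine memℓp_gen ?_
    refine (hc.summable h2).comp_injective (i := fun s : ℤ => s * p + (t : ℕ)) fun s s' hss => ?_
    have : (p : ℤ) ≠ 0 := by exact_mod_cast NeZero.ne p
    exact mul_right_cancel₀ this (add_right_cancel hss)
  choose h hh hhc using fun t => exists_fourierCoeff_eq (T := 1) (hct t)
  set F : ℤ → Fin p → AddCircle (1 : ℝ) → ℂ := fun k t z =>
    ∑' s : ℤ, g (x + ((t : ℕ) * T - α * k) + s * (p * T)) * fourier (-s) z with hF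
  have hFint : ∀ k t, Integrable (fun z => F k t z * h t z) AddCircle.haarAddCircle := fun k t =>
    integrable_mul_tsum_mul_fourier_neg (hgsum (mul_pos hp hT) _) (hh t)
  obtain ⟨C, hC⟩ := (hc.of_exponent_ge le_top).bddAbove
  have hsumG : ∀ k : ℤ, Summable fun j : ℤ => c j * g (x + j * T - α * k) := fun k => by
    refine Summable.of_norm_bounded ((hgsum hT (x - α * k)).mul_left C) fun j => ?_
    rw [norm_mul, add_sub_right_comm]
    exact mul_le_mul_of_nonneg_right (hC ⟨j, rfl⟩) (norm_nonneg _)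
  have hcoeff : ∀ k m : ℤ, fourierCoeff (fun z => ∑ t, F k t z * h t z) m = 0 := fun k m => by
    have h1 : fourierCoeff (fun z => ∑ t, F k t z * h t z) m =
        ∑ t, fourierCoeff (fun z => F k t z * h t z) m := by
      simp only [fourierCoeff, smul_eq_mul, Finset.mul_sum]
      refine integral_finsetSum _ fun t _ => (hFint k t).bdd_mul (c := 1)
        (fourier _).continuous.aestronglyMeasurable
        (Filter.Eventually.of_forall fun z => (norm_fourier_apply _ z).le)
    rw [h1, ← h0 (k + q * m), tsum_int_eq_sum_tsum_mul_add (p := p) (hsumG _)]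
    refine Finset.sum_congr rfl fun t _ => ?_
    rw [fourierCoeff_tsum_mul_fourier_neg_mul (hgsum (mul_pos hp hT) _) (hh t)]
    simp_rw [hhc]
    rw [← (Equiv.addLeft m).tsum_eq (fun s : ℤ => c (s * p + (t : ℕ)) *
      g (x + ((s * p + (t : ℕ) : ℤ) : ℝ) * T - α * (k + q * m : ℤ)))]
    refine tsum_congr fun s => ?_
    rw [mul_comm, Equiv.coe_addLeft]
    congr 2
    push_cast
    linear_combination (m : ℝ) * hpq
  have hae : ∀ᵐ z ∂AddCircle.haarAddCircle, ∀ k : ℤ, ∑ t, F k t z * h t z = 0 :=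
    ae_all_iff.mpr fun k => ae_eq_zero_of_fourierCoeff_eq_zero
      (integrable_finsetSum _ fun t _ => hFint k t) (hcoeff k)
  have hdet : ∀ᵐ z ∂(AddCircle.haarAddCircle (T := 1)), ∀ ξ : ℝ, (ξ : AddCircle (1 : ℝ)) = z →
      (zakMatrix g α T p l x ((-ξ : ℝ) : ℂ)).det ≠ 0 := by
    have hN : ((fun ξ : ℝ => (ξ : AddCircle (1 : ℝ))) ''
        {ξ : ℝ | (zakMatrix g α T p l x ((-ξ : ℝ) : ℂ)).det = 0}).Countable :=
      Set.Countable.image (hx.preimage neg_injective) _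
    have : Nontrivial (Set.Ico (0 : ℝ) (0 + 1)) :=
      Set.nontrivial_coe_sort.mpr (Set.Ico_infinite (by norm_num)).nontrivial
    have : Nontrivial (AddCircle (1 : ℝ)) :=
      (AddCircle.equivIco (1 : ℝ) 0).symm.injective.nontrivial
    filter_upwards [measure_eq_zero_iff_ae_notMem.mp (hN.measure_zero AddCircle.haarAddCircle)]
      with z hz ξ hξ h0
    exact hz ⟨ξ, h0, hξ⟩
  have hzero : ∀ t, h t =ᵐ[AddCircle.haarAddCircle] 0 := fun t => by
    filter_upwards [hae, hdet] with z hz hz'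
    obtain ⟨ξ, rfl⟩ := QuotientAddGroup.mk_surjective z
    refine congrFun (Matrix.eq_zero_of_mulVec_eq_zero (hz' ξ rfl)
      (v := fun t => h t (ξ : AddCircle (1 : ℝ))) ?_) t
    funext i
    have hF' : ∀ k t, F k t (ξ : AddCircle (1 : ℝ)) =
      zak g (p * T) (x + ((t : ℕ) * T - α * k)) ((-ξ : ℝ) : ℂ) := fun k t =>
        tsum_fourier_eq_zak g (p * T) _ ξ
    simp only [Matrix.mulVec, dotProduct, zakMatrix, Matrix.of_apply, Finsupp.sum, ← hF',
      Pi.zero_apply, Finset.sum_mul]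
    rw [Finset.sum_comm]
    refine Finset.sum_eq_zero fun k _ => ?_
    simp_rw [mul_assoc, ← Finset.mul_sum]
    rw [hz k, mul_zero, mul_zero]
  funext j
  obtain ⟨⟨s, t⟩, rfl⟩ := (Int.divModEquiv p).symm.surjective j
  rw [Int.divModEquiv_symm_apply, ← hhc, fourierCoeff, integral_congr_ae (g := 0)]
  · simp
  · filter_upwards [hzero t] with z hz
    simp [hz]

lemma memLp_two_polynomial_mul_gaussian (P : Polynomial ℂ) :
    MemLp (fun y : ℝ => P.eval (y : ℂ) * (Real.exp (-π * y ^ 2) : ℝ)) 2 := by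
  obtain ⟨K, hK⟩ := exists_norm_eval_mul_exp_le P
  have hcont : Continuous fun y : ℝ => P.eval (y : ℂ) * (Real.exp (-π * y ^ 2) : ℝ) := by fun_prop
  refine (memLp_two_iff_integrable_sq_norm hcont.aestronglyMeasurable).mpr ?_
  refine ((integrable_exp_neg_mul_sq pi_pos).const_mul (K ^ 2)).mono'
    (hcont.norm.pow 2).aestronglyMeasurable (.of_forall fun y => ?_)
  rw [Real.norm_of_nonneg (by positivity)]
  refine (pow_le_pow_left₀ (norm_nonneg _) (hK y) 2).trans_eq ?_
  rw [mul_pow, ← Real.exp_nat_mul]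
  ring_nf

lemma memLp_hermiteFn (n : ℕ) : MemLp (hermiteFn n) 2 := by
  obtain ⟨P, -, hP⟩ := exists_polynomial_hermiteFn n
  rw [funext hP]
  exact memLp_two_polynomial_mul_gaussian P

lemma memLp_exp_mul_translate {g : ℝ → ℂ} (hg : MemLp g 2) (b a : ℝ) :
    MemLp (fun x : ℝ => cexp (2 * π * I * (b * x)) * g (x - a)) 2 := by
  have hg' : MemLp (fun x => g (x - a)) 2 :=
    hg.comp_measurePreserving (measurePreserving_sub_right volume a)
  refine hg'.of_le ((by fun_prop : Continuous fun x : ℝ =>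
    cexp (2 * π * I * (b * x))).aestronglyMeasurable.mul hg'.1) (.of_forall fun x => ?_)
  have : (2 * π * I * (b * x) : ℂ) = (2 * π * (b * x) : ℝ) * I := by push_cast; ring
  rw [norm_mul, this, norm_exp_ofReal_mul_I, one_mul]

/-- A Gabor system is complete if every function in `L²` orthogonal to it vanishes. -/
theorem gaborComplete_of_forall_integral {g : ℝ → ℂ} (hg : MemLp g 2)
    (hreal : ∀ x, starRingEnd ℂ (g x) = g x) {α β : ℝ}
    (h : ∀ f : ℝ → ℂ, MemLp f 2 →
      (∀ k l : ℤ, ∫ x : ℝ, cexp (2 * π * I * (β * l * x)) * (f x * g (x - α * k)) = 0) →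
      ∀ᵐ x, f x = 0) : GaborComplete g α β := by
  rw [GaborComplete, Submodule.topologicalClosure_eq_top_iff, Submodule.eq_bot_iff]
  intro f hf
  rw [Lp.eq_zero_iff_ae_eq_zero]
  refine h f (Lp.memLp f) fun k l => ?_
  have hs := memLp_exp_mul_translate hg (β * (-l : ℤ)) (α * k)
  have h1 := (Submodule.mem_orthogonal _ _).mp hf hs.toLp (Submodule.subset_span ⟨k, -l, by
    filter_upwards [hs.coeFn_toLp] with x hx
    rw [hx]; push_cast; rfl⟩)
  rw [L2.inner_def] at h1
  rw [← h1]
  refine integral_congr_ae ?_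
  filter_upwards [hs.coeFn_toLp] with x hx
  rw [hx, RCLike.inner_apply, map_mul, hreal, ← Complex.exp_conj]
  simp only [map_mul, conj_ofReal, conj_I, map_ofNat]
  push_cast
  ring_nf

theorem stmt_4 (n : ℕ) (α β : ℝ) (hα : 0 < α) (hβ : 0 < β)
    (hrat : ∃ r : ℚ, α * β = (r : ℝ)) (hle : α * β ≤ 1) :
    GaborComplete (hermiteFn n) α β := by
  obtain ⟨r, hr⟩ := hrat
  have hg := memLp_hermiteFn n
  refine gaborComplete_of_forall_integral hg (fun x => conj_ofReal _) fun f hf h0 => ?_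
  obtain ⟨P, hP0, hP⟩ := exists_polynomial_hermiteFn n
  obtain ⟨K, hK⟩ := exists_norm_eval_mul_exp_le P
  have hT : 0 < β⁻¹ := inv_pos.mpr hβ
  have hr0 : 0 < r := by
    have := mul_pos hα hβ
    rw [hr] at this
    exact_mod_cast this
  have hnum := Rat.num_pos.mpr hr0
  have : NeZero r.num.toNat := ⟨by omega⟩
  have hpq : α * (r.den : ℕ) = (r.num.toNat : ℕ) * β⁻¹ := by
    have h1 : ((r.num.toNat : ℕ) : ℝ) = r * r.den := by
      have h2 : ((r.num.toNat : ℤ) : ℚ) = r * r.den := by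
        rw [Int.toNat_of_nonneg hnum.le, Rat.mul_den_eq_num]
      exact_mod_cast h2
    rw [h1, ← hr]
    field_simp
  have hαT : α ≤ β⁻¹ := by rwa [inv_eq_one_div, le_div_iff₀ hβ]
  obtain ⟨l, hl⟩ := exists_finsupp_zakMatrix hP0 hα hαT r.num.toNat
  have hshift (k : ℤ) : MemLp (fun x => hermiteFn n (x - α * k)) 2 :=
    hg.comp_measurePreserving (measurePreserving_sub_right volume (α * k))
  have htsum : ∀ᵐ x, ∀ k : ℤ,
      ∑' j : ℤ, f (x + j * β⁻¹) * hermiteFn n (x + j * β⁻¹ - α * k) = 0 := by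
    refine ae_all_iff.mpr fun k => ae_tsum_eq_zero_of_integral_exp_mul_eq_zero hT
      (u := fun x => f x * hermiteFn n (x - α * k)) (hf.integrable_mul (hshift k)) fun m => ?_
    rw [← h0 k m]
    refine integral_congr_ae (.of_forall fun x => ?_)
    have : (2 * π * I * m * x / (β⁻¹ : ℝ) : ℂ) = 2 * π * I * (β * m * x) := by
      push_cast
      rw [div_inv_eq_mul]
      ring
    simp only [this]
  have hsum := ae_summable_norm_periodization hT
    (((memLp_two_iff_integrable_sq_norm hf.1).mp hf).ofReal (𝕜 := ℂ))
  filter_upwards [htsum, hsum, measure_eq_zero_iff_ae_notMem.mp (hl.measure_zero volume)]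
    with x hx hx2 hxl
  have hc : Memℓp (fun j : ℤ => f (x + j * β⁻¹)) 2 := by
    refine memℓp_gen (hx2.congr fun j => ?_)
    simp
  have h := eq_zero_of_tsum_mul_translate_eq_zero (by positivity) hT hK hpq
    (not_not.mp hxl) hc (by simpa only [hP] using hx)
  simpa using congrFun h 0
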